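/- Let f, f* be conjugate special Bernstein functions (f*(λ) = λ/f(λ)) with triplets (a,b,μ) and (a*,b*,μ*), and let μ̄(x) = μ((x,∞)), k(x) = μ*((x,∞)). If b = b* = 0, then the functions a + μ̄ and a* + k form a positive Sonine pair of decreasing functions: ∫₀^x (a + μ̄(x-t))(a* + k(t)) dt = 1 for all x > 0. -/

import Mathlib

open MeasureTheory Real Set

open Filter Topology ProbabilityTheory

/-- Laplace transform of a nonnegative function. -/
noncomputable def LTr (C : ℝ → ENNReal) (l : ℝ) : ENNReal :=
  ∫⁻ t, C t * ENNReal.ofReal (Real.exp (-(l * t)))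

/-- The tail function `a + μ((t,∞))` on `(0,∞)`, extended by zero. -/
noncomputable def tailG (a : ℝ) (μ : Measure ℝ) : ℝ → ENNReal :=
  (Set.Ioi (0:ℝ)).indicator (fun t => ENNReal.ofReal a + μ (Set.Ioi t))

lemma LTr_anti {C : ℝ → ENNReal} (h0 : ∀ t ≤ 0, C t = 0) {l l' : ℝ} (h : l ≤ l') :
    LTr C l' ≤ LTr C l := by
  unfold LTr
  refine lintegral_mono fun t => ?_
  rcases le_or_gt t 0 with ht | ht
  · simp [h0 t ht]
  · dsimp only
    gcongr

lemma LTr_top {C : ℝ → ENNReal} (h0 : ∀ t ≤ 0, C t = 0)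
    (hL : ∀ l > 0, LTr C l = ENNReal.ofReal (1 / l)) {l : ℝ} (hl : l ≤ 0) : LTr C l = ⊤ := by
  refine ENNReal.eq_top_of_forall_nnreal_le fun r => ?_
  have hr : (0:ℝ) < 1 / (r + 1) := by positivity
  refine le_trans ?_ (LTr_anti h0 (hl.trans hr.le))
  rw [hL _ hr, one_div_one_div]
  rw [← ENNReal.ofReal_coe_nnreal]
  exact ENNReal.ofReal_le_ofReal (by linarith)

lemma LTr_eq {C D : ℝ → ENNReal} (h0 : ∀ t ≤ 0, C t = 0) (h0' : ∀ t ≤ 0, D t = 0)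
    (hL : ∀ l > 0, LTr C l = ENNReal.ofReal (1 / l))
    (hL' : ∀ l > 0, LTr D l = ENNReal.ofReal (1 / l)) (l : ℝ) : LTr C l = LTr D l := by
  rcases le_or_gt l 0 with hl | hl
  · rw [LTr_top h0 hL hl, LTr_top h0' hL' hl]
  · rw [hL l hl, hL' l hl]

/-- exponentially tilted measure -/
noncomputable def tiltM (C : ℝ → ENNReal) : Measure ℝ :=
  volume.withDensity (fun t => C t * ENNReal.ofReal (Real.exp (-(1 * t))))

lemma lint_tilt {C : ℝ → ENNReal} (hC : Measurable C) (s : ℝ) :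
    ∫⁻ t, ENNReal.ofReal (Real.exp (s * t)) ∂(tiltM C) = LTr C (1 - s) := by
  unfold tiltM LTr
  rw [lintegral_withDensity_eq_lintegral_mul _ (by fun_prop) (by fun_prop)]
  refine lintegral_congr fun t => ?_
  simp only [Pi.mul_apply]
  rw [mul_assoc, ← ENNReal.ofReal_mul (by positivity), ← Real.exp_add]
  congr 3
  ring

lemma mgf_tilt {C : ℝ → ENNReal} (hC : Measurable C) (s : ℝ) :
    mgf id (tiltM C) s = (LTr C (1 - s)).toReal := by
  rw [← lint_tilt hC]
  unfold mgf
  rw [integral_eq_lintegral_of_nonneg_ae (ae_of_all _ fun t => (Real.exp_pos _).le)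
    (by fun_prop)]
  simp

lemma tilt_prob {C : ℝ → ENNReal} (hL : ∀ l > 0, LTr C l = ENNReal.ofReal (1 / l)) :
    IsProbabilityMeasure (tiltM C) := by
  constructor
  unfold tiltM
  rw [withDensity_apply _ MeasurableSet.univ, Measure.restrict_univ]
  have := hL 1 one_pos
  unfold LTr at this
  rw [this]; simp

lemma laplace_uniq {C D : ℝ → ENNReal} (hC : Measurable C) (hD : Measurable D)
    (h0 : ∀ t ≤ 0, C t = 0) (h0' : ∀ t ≤ 0, D t = 0)
    (hL : ∀ l > 0, LTr C l = ENNReal.ofReal (1 / l))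
    (hL' : ∀ l > 0, LTr D l = ENNReal.ofReal (1 / l)) : C =ᵐ[volume] D := by
  have p1 := tilt_prob hL
  have p2 := tilt_prob hL'
  have hm : mgf id (tiltM C) = mgf id (tiltM D) := by
    ext s
    rw [mgf_tilt hC, mgf_tilt hD, LTr_eq h0 h0' hL hL']
  have hE := eqOn_complexMGF_of_mgf hm
  have hint : (0:ℝ) ∈ interior (integrableExpSet id (tiltM C)) := by
    rw [mem_interior]
    refine ⟨Set.Iio 1, fun s hs => ?_, isOpen_Iio, by simp⟩
    have hs' : 0 < 1 - s := sub_pos.2 hs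
    refine ⟨by fun_prop, ?_⟩
    rw [hasFiniteIntegral_iff_ofReal (ae_of_all _ fun t => (Real.exp_pos _).le)]
    have := lint_tilt hC s
    simp only [id]
    rw [this, hL _ hs']
    exact ENNReal.ofReal_lt_top
  have heq : tiltM C = tiltM D := by
    apply Measure.ext_of_charFun
    ext t
    rw [← complexMGF_id_mul_I, ← complexMGF_id_mul_I]
    apply hE
    simpa using hint
  unfold tiltM at heq
  rw [withDensity_eq_iff (by fun_prop) (by fun_prop)
    (by have := hL 1 one_pos; unfold LTr at this; rw [this]; exact ENNReal.ofReal_ne_top)] at heq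
  filter_upwards [heq] with t ht
  refine (ENNReal.mul_left_inj ?_ ?_).1 ht
  · simpa using Real.exp_pos _
  · exact ENNReal.ofReal_ne_top

lemma lint_exp {l : ℝ} (hl : 0 < l) :
    ∫⁻ t in Set.Ioi (0:ℝ), ENNReal.ofReal (Real.exp (-(l * t))) = ENNReal.ofReal (1 / l) := by
  have h1 := integral_exp_mul_Ioi (neg_lt_zero.2 hl) 0
  have h2 := integrableOn_exp_mul_Ioi (neg_lt_zero.2 hl) 0
  simp only [neg_mul] at h1 h2
  rw [← ofReal_integral_eq_lintegral_ofReal h2 (ae_of_all _ fun t => (Real.exp_pos _).le), h1]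
  simp

lemma tailG_zero (a : ℝ) (μ : Measure ℝ) : ∀ t ≤ 0, tailG a μ t = 0 := by
  intro t ht
  simp [tailG, ht]

lemma tailG_pos (a : ℝ) (μ : Measure ℝ) {t : ℝ} (ht : 0 < t) :
    tailG a μ t = ENNReal.ofReal a + μ (Set.Ioi t) := by
  simp [tailG, ht]

lemma meas_tail (μ : Measure ℝ) : Measurable (fun t => μ (Set.Ioi t)) := by
  apply Antitone.measurable
  intro s t h
  exact measure_mono (Ioi_subset_Ioi h)

lemma tailG_meas (a : ℝ) (μ : Measure ℝ) : Measurable (tailG a μ) := by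
  unfold tailG
  exact ((meas_tail μ).const_add _).indicator measurableSet_Ioi

lemma tailG_anti (a : ℝ) (μ : Measure ℝ) {s t : ℝ} (hs : 0 < s) (h : s ≤ t) :
    tailG a μ t ≤ tailG a μ s := by
  rw [tailG_pos a μ hs, tailG_pos a μ (hs.trans_le h)]
  gcongr

lemma one_sub_exp_le {l t : ℝ} (ht : 0 < t) :
    1 - Real.exp (-(l * t)) ≤ max l 1 * min t 1 := by
  have h1 := Real.add_one_le_exp (-(l * t))
  have h2 := Real.exp_pos (-(l * t))
  have h3 := le_max_left l 1
  have h4 := le_max_right l 1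
  rcases le_total t 1 with h | h
  · rw [min_eq_left h]; nlinarith
  · rw [min_eq_right h]; linarith

lemma restr_eq {μ : Measure ℝ} (hμ0 : μ (Set.Iic 0) = 0) : μ.restrict (Set.Ioi 0) = μ := by
  apply Measure.restrict_eq_self_of_ae_mem
  rw [ae_iff]
  convert hμ0 using 2
  ext; simp

lemma integ {μ : Measure ℝ} (hμ0 : μ (Set.Iic 0) = 0)
    (hμ : (∫⁻ t, ENNReal.ofReal (min t 1) ∂μ) < ⊤) {l : ℝ} (hl : 0 < l) :
    IntegrableOn (fun t => 1 - Real.exp (-(l * t))) (Set.Ioi 0) μ := by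
  have : IntegrableOn (fun t : ℝ => max l 1 * min t 1) (Set.Ioi 0) μ := by
    apply Integrable.const_mul
    refine ⟨by fun_prop, ?_⟩
    rw [hasFiniteIntegral_iff_ofReal]
    · rwa [restr_eq hμ0]
    · filter_upwards [ae_restrict_mem measurableSet_Ioi] with t ht
      exact le_min (le_of_lt ht) zero_le_one
  refine this.mono' (by fun_prop) ?_
  filter_upwards [ae_restrict_mem measurableSet_Ioi] with t ht
  have ht : 0 < t := ht
  rw [Real.norm_eq_abs, abs_of_nonneg]
  · exact one_sub_exp_le ht
  · have : Real.exp (-(l * t)) ≤ 1 := Real.exp_le_one_iff.2 (by nlinarith)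
    linarith

lemma tail_fin {μ : Measure ℝ} (hμ : (∫⁻ t, ENNReal.ofReal (min t 1) ∂μ) < ⊤) {t : ℝ}
    (ht : 0 < t) : μ (Set.Ioi t) < ⊤ := by
  have h := meas_ge_le_lintegral_div (μ := μ) (f := fun t : ℝ => ENNReal.ofReal (min t 1))
    (by fun_prop) (ε := ENNReal.ofReal (min t 1)) (by simp [ht]) ENNReal.ofReal_ne_top
  refine lt_of_le_of_lt (measure_mono ?_) (h.trans_lt ?_)
  · intro s hs
    have : t < s := hs
    exact ENNReal.ofReal_le_ofReal (min_le_min_right _ this.le)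
  · exact ENNReal.div_lt_top hμ.ne (by simp [ht])

lemma tailG_fin {a : ℝ} {μ : Measure ℝ} (hμ : (∫⁻ t, ENNReal.ofReal (min t 1) ∂μ) < ⊤) (t : ℝ) :
    tailG a μ t ≠ ⊤ := by
  rcases le_or_gt t 0 with h | h
  · simp [tailG_zero a μ t h]
  · rw [tailG_pos a μ h]
    exact ENNReal.add_ne_top.2 ⟨ENNReal.ofReal_ne_top, (tail_fin hμ h).ne⟩

lemma LTr_tail {a : ℝ} (ha : 0 ≤ a) {μ : Measure ℝ} (hμ0 : μ (Set.Iic 0) = 0)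
    (hμ : (∫⁻ t, ENNReal.ofReal (min t 1) ∂μ) < ⊤) {l : ℝ} (hl : 0 < l) :
    LTr (tailG a μ) l = ENNReal.ofReal
      ((a + ∫ t in Set.Ioi (0:ℝ), (1 - Real.exp (-(l * t))) ∂μ) / l) := by
  have e1 : LTr (tailG a μ) l = ∫⁻ t in Set.Ioi (0:ℝ),
      (ENNReal.ofReal a * ENNReal.ofReal (Real.exp (-(l * t))) +
        μ (Set.Ioi t) * ENNReal.ofReal (Real.exp (-(l * t)))) := by
    unfold LTr
    rw [← lintegral_indicator measurableSet_Ioi]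
    refine lintegral_congr fun t => ?_
    by_cases ht : 0 < t
    · simp [tailG, ht, add_mul]
    · simp [tailG, ht]
  have nn : 0 ≤ᵐ[μ.restrict (Set.Ioi 0)] fun t => 1 - Real.exp (-(l * t)) := by
    filter_upwards [ae_restrict_mem measurableSet_Ioi] with t ht
    have ht : 0 < t := ht
    have : Real.exp (-(l * t)) ≤ 1 := Real.exp_le_one_iff.2 (by nlinarith)
    simpa using this
  have lc := lintegral_comp_eq_lintegral_meas_lt_mul (f := fun t : ℝ => t)
    (g := fun t => Real.exp (-(l * t))) μ
    (by
      rw [← restr_eq hμ0]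
      filter_upwards [ae_restrict_mem measurableSet_Ioi] with t ht using le_of_lt ht)
    (by fun_prop) (fun t _ => Continuous.intervalIntegrable (by fun_prop) _ _)
    (ae_of_all _ fun t => (Real.exp_pos _).le)
  have e2 : ∀ s : ℝ, ∫ t in (0:ℝ)..s, Real.exp (-(l * t)) = (1 - Real.exp (-(l * s))) / l := by
    intro s
    have : ∀ x ∈ Set.uIcc 0 s, HasDerivAt (fun t => - Real.exp (-(l * t)) / l)
        (Real.exp (-(l * x))) x := by
      intro x _
      have h1 : HasDerivAt (fun t : ℝ => -(l * t)) (-(l * 1)) x :=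
        ((hasDerivAt_id x).const_mul l).neg
      have h2 : Real.exp (-(l * x)) = -(Real.exp (-(l * x)) * -(l * 1)) / l := by
        field_simp
      rw [h2]
      exact (h1.exp.neg).div_const l
    rw [intervalIntegral.integral_eq_sub_of_hasDerivAt this
      (Continuous.intervalIntegrable (by fun_prop) _ _)]
    simp; ring
  rw [e1, lintegral_add_left (by fun_prop), lintegral_const_mul _ (by fun_prop), lint_exp hl]
  change _ + ∫⁻ t in Set.Ioi (0:ℝ), μ {a | t < a} * ENNReal.ofReal (Real.exp (-(l * t))) = _
  rw [← lc]
  simp only [e2]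
  rw [add_div, ENNReal.ofReal_add (by positivity)
    (div_nonneg (integral_nonneg_of_ae nn) hl.le), ← ENNReal.ofReal_mul ha, mul_one_div]
  congr 1
  rw [← integral_div, ofReal_integral_eq_lintegral_ofReal ((integ hμ0 hμ hl).div_const l)]
  · rw [restr_eq hμ0]
  · filter_upwards [nn] with t ht using div_nonneg ht hl.le

/-- convolution -/
noncomputable def cnv (G H : ℝ → ENNReal) (x : ℝ) : ENNReal := ∫⁻ t, G (x - t) * H t

lemma cnv_meas {G H : ℝ → ENNReal} (hG : Measurable G) (hH : Measurable H) :
    Measurable (cnv G H) := by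
  unfold cnv
  apply Measurable.lintegral_prod_right'
    (f := fun p : ℝ × ℝ => G (p.1 - p.2) * H p.2)
  fun_prop

lemma cnv_zero {G H : ℝ → ENNReal} (hG : ∀ t ≤ 0, G t = 0) (hH : ∀ t ≤ 0, H t = 0) :
    ∀ t ≤ 0, cnv G H t = 0 := by
  intro x hx
  unfold cnv
  rw [← lintegral_zero (μ := (volume : Measure ℝ))]
  refine lintegral_congr fun t => ?_
  rcases le_or_gt t 0 with h | h
  · simp [hH t h]
  · simp [hG (x - t) (by linarith)]

lemma LTr_cnv {G H : ℝ → ENNReal} (hG : Measurable G) (hH : Measurable H) (l : ℝ) :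
    LTr (cnv G H) l = LTr G l * LTr H l := by
  unfold LTr cnv
  have : ∀ x : ℝ, (∫⁻ t, G (x - t) * H t) * ENNReal.ofReal (Real.exp (-(l * x))) =
      ∫⁻ t, (G (x - t) * ENNReal.ofReal (Real.exp (-(l * (x - t))))) *
        (H t * ENNReal.ofReal (Real.exp (-(l * t)))) := by
    intro x
    rw [← lintegral_mul_const _ (by fun_prop)]
    refine lintegral_congr fun t => ?_
    have : Real.exp (-(l * x)) = Real.exp (-(l * (x - t))) * Real.exp (-(l * t)) := by
      rw [← Real.exp_add]; congr 1; ring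
    rw [this, ENNReal.ofReal_mul (by positivity)]
    ring
  simp only [this]
  rw [lintegral_lintegral_swap (by fun_prop)]
  have : ∀ t : ℝ, ∫⁻ x, (G (x - t) * ENNReal.ofReal (Real.exp (-(l * (x - t))))) *
        (H t * ENNReal.ofReal (Real.exp (-(l * t)))) =
      (∫⁻ x, G x * ENNReal.ofReal (Real.exp (-(l * x)))) *
        (H t * ENNReal.ofReal (Real.exp (-(l * t)))) := by
    intro t
    rw [lintegral_mul_const _ (by fun_prop)]
    rw [lintegral_sub_right_eq_self (fun x => G x * ENNReal.ofReal (Real.exp (-(l * x)))) t]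
  simp only [this]
  rw [lintegral_const_mul _ (by fun_prop)]

lemma tailG_rc {a : ℝ} {μ : Measure ℝ} {x : ℝ} {u : ℕ → ℝ} (hu : StrictAnti u)
    (hx : ∀ n, x < u n) (hlim : Tendsto u atTop (𝓝 x)) {s : ℝ} (hs : s < x) :
    Tendsto (fun n => tailG a μ (u n - s)) atTop (𝓝 (tailG a μ (x - s))) := by
  have h1 : ∀ n, tailG a μ (u n - s) = ENNReal.ofReal a + μ (Set.Ioi (u n - s)) := fun n =>
    tailG_pos a μ (by linarith [hx n])
  simp only [h1]
  rw [tailG_pos a μ (sub_pos.2 hs)]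
  refine Tendsto.const_add _ ?_
  have h := tendsto_measure_iUnion_atTop (μ := μ) (s := fun n => Set.Ioi (u n - s))
    (fun m n hmn => Ioi_subset_Ioi (by linarith [hu.antitone hmn]))
  suffices hU : Set.Ioi (x - s) = ⋃ n, Set.Ioi (u n - s) by
    rw [hU]; exact h
  ext y
  simp only [mem_Ioi, mem_iUnion]
  constructor
  · intro hy
    have : x < y + s := by linarith
    obtain ⟨n, hn⟩ := (hlim.eventually_lt_const this).exists
    exact ⟨n, by linarith⟩
  · rintro ⟨n, hn⟩
    linarith [hx n]

lemma cnv_one {a b : ℝ} {μ ν : Measure ℝ}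
    (hfin : LTr (tailG a μ) 1 ≠ ⊤)
    (hν : (∫⁻ t, ENNReal.ofReal (min t 1) ∂ν) < ⊤)
    (hae : ∀ᵐ x : ℝ, 0 < x → cnv (tailG a μ) (tailG b ν) x = 1) {x : ℝ} (hx : 0 < x) :
    cnv (tailG a μ) (tailG b ν) x = 1 := by
  obtain ⟨u, hu, hmem, hlim⟩ := (Measure.dense_of_ae hae).exists_seq_strictAnti_tendsto x
  have hux : ∀ n, x < u n := fun n => (hmem n).1
  have hu1 : ∀ n, cnv (tailG a μ) (tailG b ν) (u n) = 1 := fun n =>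
    (hmem n).2 (hx.trans (hux n))
  have mG := tailG_meas a μ
  have mH := tailG_meas b ν
  apply le_antisymm
  · have hF := lintegral_liminf_le (μ := (volume : Measure ℝ)) (u := atTop)
      (f := fun n t => tailG a μ (u n - t) * tailG b ν t) (fun n => by fun_prop)
    have : liminf (fun n => ∫⁻ t, tailG a μ (u n - t) * tailG b ν t) atTop = 1 := by
      have : (fun n => ∫⁻ t, tailG a μ (u n - t) * tailG b ν t) = fun n => 1 := by
        ext n; exact hu1 n
      rw [this]; simp
    rw [this] at hF
    refine le_trans (lintegral_mono fun t => ?_) hF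
    rcases lt_or_ge t x with h | h
    · exact (ENNReal.Tendsto.mul_const (tailG_rc hu hux hlim h)
        (Or.inr (tailG_fin hν t))).liminf_eq.ge
    · simp [tailG_zero a μ (x - t) (by linarith)]
  · -- lower bound
    set K : ℝ → ENNReal := fun t => tailG a μ t * ENNReal.ofReal (Real.exp (-(1 * t))) with hK
    have mK : Measurable K := by fun_prop
    have key : ∀ n, 1 ≤ cnv (tailG a μ) (tailG b ν) x +
        (∫⁻ t in Set.Ioc 0 (u n - x), K t) *
          (ENNReal.ofReal (Real.exp (u n - x)) * tailG b ν x) := by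
      intro n
      rw [← hu1 n]
      have e : (∫⁻ t in Set.Ioc 0 (u n - x), K t) *
          (ENNReal.ofReal (Real.exp (u n - x)) * tailG b ν x) =
          ∫⁻ t, (Set.Ioc 0 (u n - x)).indicator K (u n - t) *
            (ENNReal.ofReal (Real.exp (u n - x)) * tailG b ν x) := by
        have mI : Measurable fun t => (Set.Ioc 0 (u n - x)).indicator K (u n - t) :=
          (mK.indicator measurableSet_Ioc).comp (measurable_const.sub measurable_id)
        rw [lintegral_mul_const _ mI,
          lintegral_sub_left_eq_self, lintegral_indicator measurableSet_Ioc]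
      rw [e]
      unfold cnv
      rw [← lintegral_add_left (by fun_prop)]
      refine lintegral_mono fun t => ?_
      dsimp only
      rcases lt_or_ge t x with h | h
      · refine le_trans ?_ le_self_add
        gcongr
        exact tailG_anti a μ (by linarith) (by linarith [hux n])
      · rcases le_or_gt (u n) t with h' | h'
        · simp [tailG_zero a μ (u n - t) (by linarith)]
        refine le_trans ?_ le_add_self
        rw [indicator_of_mem (by constructor <;> linarith), hK]
        dsimp only
        rw [mul_assoc]
        gcongr
        rw [← mul_assoc, ← ENNReal.ofReal_mul (by positivity), ← Real.exp_add]
        calc tailG b ν t ≤ tailG b ν x := tailG_anti b ν hx h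
          _ = 1 * tailG b ν x := (one_mul _).symm
          _ ≤ _ := by
            gcongr
            rw [← ENNReal.ofReal_one]
            apply ENNReal.ofReal_le_ofReal
            apply Real.one_le_exp
            linarith
    have hlim0 : Tendsto (fun n => ∫⁻ t in Set.Ioc 0 (u n - x), K t) atTop (𝓝 0) := by
      apply tendsto_setLIntegral_zero hfin
      have : Tendsto (fun n => ENNReal.ofReal (u n - x)) atTop (𝓝 (ENNReal.ofReal (x - x))) :=
        ENNReal.tendsto_ofReal (hlim.sub_const x)
      simpa [Function.comp_def] using this
    have hlim1 : Tendsto (fun n => ENNReal.ofReal (Real.exp (u n - x)) * tailG b ν x) atTop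
        (𝓝 (ENNReal.ofReal (Real.exp (x - x)) * tailG b ν x)) := by
      refine ENNReal.Tendsto.mul_const (ENNReal.tendsto_ofReal ?_) (Or.inr (tailG_fin hν x))
      exact (Real.continuous_exp.tendsto _).comp (hlim.sub_const x)
    have h2 := ENNReal.Tendsto.mul hlim0
      (Or.inr (ENNReal.mul_ne_top ENNReal.ofReal_ne_top (tailG_fin hν x))) hlim1
      (Or.inr ENNReal.zero_ne_top)
    have h3 := ge_of_tendsto' (h2.const_add (cnv (tailG a μ) (tailG b ν) x)) key
    simpa using h3

theorem conjugate_special_bernstein_sonine_pair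
    (a astar : ℝ) (ha : 0 ≤ a) (has : 0 ≤ astar)
    (μ μs : Measure ℝ) (hμ0 : μ (Set.Iic 0) = 0) (hμs0 : μs (Set.Iic 0) = 0)
    (hμ : (∫⁻ t, ENNReal.ofReal (min t 1) ∂μ) < ⊤)
    (hμs : (∫⁻ t, ENNReal.ofReal (min t 1) ∂μs) < ⊤)
    (hconj : ∀ l > (0:ℝ),
      (a + ∫ t in Set.Ioi (0:ℝ), (1 - Real.exp (-(l * t))) ∂μ) *
        (astar + ∫ t in Set.Ioi (0:ℝ), (1 - Real.exp (-(l * t))) ∂μs) = l) :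
    ∀ x > (0:ℝ),
      (∫ t in (0:ℝ)..x,
        (a + (μ (Set.Ioi (x - t))).toReal) * (astar + (μs (Set.Ioi t)).toReal)) = 1 := by
  intro x hx
  have mG := tailG_meas a μ
  have mH := tailG_meas astar μs
  have nn : ∀ l > (0:ℝ), 0 ≤ (a + ∫ t in Set.Ioi (0:ℝ), (1 - Real.exp (-(l * t))) ∂μ) / l := by
    intro l hl
    refine div_nonneg (add_nonneg ha (setIntegral_nonneg measurableSet_Ioi fun t ht => ?_)) hl.le
    have ht : 0 < t := ht
    have : Real.exp (-(l * t)) ≤ 1 := Real.exp_le_one_iff.2 (by nlinarith)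
    linarith
  have hL : ∀ l > 0, LTr (cnv (tailG a μ) (tailG astar μs)) l = ENNReal.ofReal (1 / l) := by
    intro l hl
    rw [LTr_cnv mG mH, LTr_tail ha hμ0 hμ hl, LTr_tail has hμs0 hμs hl,
      ← ENNReal.ofReal_mul (nn l hl), div_mul_div_comm, hconj l hl]
    congr 1
    field_simp
  have hL' : ∀ l > 0, LTr ((Set.Ioi (0:ℝ)).indicator (fun _ => 1)) l = ENNReal.ofReal (1 / l) := by
    intro l hl
    rw [← lint_exp hl, ← lintegral_indicator measurableSet_Ioi]
    refine lintegral_congr fun t => ?_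
    by_cases ht : 0 < t <;> simp [ht]
  have hae := laplace_uniq (cnv_meas mG mH) (measurable_const.indicator measurableSet_Ioi)
    (cnv_zero (tailG_zero a μ) (tailG_zero astar μs)) (fun t ht => by simp [ht]) hL hL'
  have h1 : cnv (tailG a μ) (tailG astar μs) x = 1 := by
    refine cnv_one ?_ hμs ?_ hx
    · rw [LTr_tail ha hμ0 hμ one_pos]; exact ENNReal.ofReal_ne_top
    · filter_upwards [hae] with y hy hy0
      rw [hy]; simp [hy0]
  have mI : Measurable fun t => (a + (μ (Set.Ioi (x - t))).toReal) *
      (astar + (μs (Set.Ioi t)).toReal) :=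
    (((meas_tail μ).comp (measurable_const.sub measurable_id)).ennreal_toReal.const_add a).mul
      ((meas_tail μs).ennreal_toReal.const_add astar)
  rw [intervalIntegral.integral_of_le hx.le, integral_Ioc_eq_integral_Ioo,
    integral_eq_lintegral_of_nonneg_ae (ae_of_all _ fun t => by dsimp; positivity)
      mI.aestronglyMeasurable, ← ENNReal.toReal_one, ← h1]
  congr 1
  unfold cnv
  rw [← lintegral_indicator measurableSet_Ioo]
  refine lintegral_congr fun t => ?_
  by_cases ht : t ∈ Set.Ioo 0 x
  · rw [indicator_of_mem ht, tailG_pos _ _ (sub_pos.2 ht.2), tailG_pos _ _ ht.1,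
      ENNReal.ofReal_mul (by positivity), ENNReal.ofReal_add ha (by positivity),
      ENNReal.ofReal_add has (by positivity),
      ENNReal.ofReal_toReal (tail_fin hμ (sub_pos.2 ht.2)).ne,
      ENNReal.ofReal_toReal (tail_fin hμs ht.1).ne]
  · rw [indicator_of_notMem ht]
    rcases le_or_gt t 0 with h | h
    · simp [tailG_zero _ _ t h]
    · have : x ≤ t := by
        by_contra hh
        exact ht ⟨h, not_le.1 hh⟩
      simp [tailG_zero _ _ (x - t) (by linarith)]
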